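/- There is no 5×5 matrix over a 3-letter alphabet that contains every 2×2 matrix over that alphabet as a submatrix; that is, no O(5,2,3) omnimosaic exists. -/

import Mathlib

/-- An `O(n,k,a)` omnimosaic (stated for possibly rectangular `m × n` arrays):
a matrix over the alphabet `Fin a` containing every `k × k` matrix over that
alphabet as a submatrix. -/
def IsOmnimosaic (a k : ℕ) {m n : ℕ} (M : Fin m → Fin n → Fin a) : Prop :=
  ∀ T : Fin k → Fin k → Fin a, ∃ ρ : Fin k → Fin m, ∃ σ : Fin k → Fin n,
    StrictMono ρ ∧ StrictMono σ ∧ ∀ i j, T i j = M (ρ i) (σ j)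

namespace Omni

/-- The ten index pairs `x < y` below 5. -/
def prs : List (ℕ × ℕ) :=
  [(0,1),(0,2),(0,3),(0,4),(1,2),(1,3),(1,4),(2,3),(2,4),(3,4)]

/-- The two-bit pattern (coded in 0..3) of the mask `r` in columns `x, y`. -/
def pat (r : ℕ) (p : ℕ × ℕ) : ℕ :=
  cond (r.testBit p.1) (cond (r.testBit p.2) 3 1) (cond (r.testBit p.2) 2 0)

/-- number of column pairs with top pattern `t` and bottom pattern `b`. -/
def cnt (t b ra rb : ℕ) : ℕ :=
  (prs.map fun p => cond (Nat.beq (pat ra p) t && Nat.beq (pat rb p) b) 1 0).sum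

/-- the set of column pairs with pattern `t` in row `r`, in base 256. -/
def E (t r : ℕ) : ℕ :=
  prs.foldr (fun p acc => 256 * acc + cond (Nat.beq (pat r p) t) 1 0) 0

def F (t r : ℕ) : ℕ := E t r % 255

def pop (r : ℕ) : ℕ :=
  ([0,1,2,3,4].map fun j => cond (r.testBit j) 1 0).sum

def need (t b : ℕ) : ℕ :=
  (match t with | 0 => 4 | 3 => 1 | _ => 2) * (match b with | 0 => 4 | 3 => 1 | _ => 2)

/-- sum over the ten row pairs of the pattern count, packed. -/
def hh (t b r0 r1 r2 r3 r4 : ℕ) : ℕ :=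
  ((E t r0).land (E b r1) + (E t r0).land (E b r2) + (E t r0).land (E b r3)
  + (E t r0).land (E b r4) + (E t r1).land (E b r2) + (E t r1).land (E b r3)
  + (E t r1).land (E b r4) + (E t r2).land (E b r3) + (E t r2).land (E b r4)
  + (E t r3).land (E b r4)) % 255

def chk (t b r0 r1 r2 r3 r4 : ℕ) : Bool := Nat.ble (need t b) (hh t b r0 r1 r2 r3 r4)

def good (r0 r1 r2 r3 r4 : ℕ) : Bool :=
  chk 1 1 r0 r1 r2 r3 r4 && (chk 1 2 r0 r1 r2 r3 r4 && (chk 3 2 r0 r1 r2 r3 r4 &&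
  (chk 1 3 r0 r1 r2 r3 r4 && (chk 3 3 r0 r1 r2 r3 r4 && (chk 2 3 r0 r1 r2 r3 r4 &&
  (chk 2 1 r0 r1 r2 r3 r4 && (chk 3 1 r0 r1 r2 r3 r4 && (chk 0 1 r0 r1 r2 r3 r4 &&
  (chk 0 2 r0 r1 r2 r3 r4 && (chk 1 0 r0 r1 r2 r3 r4 && chk 2 0 r0 r1 r2 r3 r4))))))))))

def topOk (r0 r1 r2 r3 : ℕ) : Bool :=
  Nat.ble 18 (4 * F 1 r0 + 3 * F 1 r1 + 2 * F 1 r2 + F 1 r3) &&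
  Nat.ble 18 (4 * F 2 r0 + 3 * F 2 r1 + 2 * F 2 r2 + F 2 r3)

def botOk (r1 r2 r3 r4 : ℕ) : Bool :=
  Nat.ble 18 (F 1 r1 + 2 * F 1 r2 + 3 * F 1 r3 + 4 * F 1 r4) &&
  Nat.ble 18 (F 2 r1 + 2 * F 2 r2 + 3 * F 2 r3 + 4 * F 2 r4)

def c2 : ℕ → ℕ
  | 0 => 0 | 1 => 0 | 2 => 1 | 3 => 3 | 4 => 6 | _ => 10

def c0 : ℕ → ℕ
  | 0 => 10 | 1 => 6 | 2 => 3 | 3 => 1 | _ => 0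

def c1 : ℕ → ℕ
  | 0 => 0 | 1 => 4 | 2 => 6 | 3 => 6 | 4 => 4 | _ => 0

def seqOk (n0 n1 n2 n3 n4 : ℕ) : Bool :=
  Nat.ble (n0 + n1 + n2 + n3 + n4) 8 &&
  (Nat.ble 9 (4 * c2 n0 + 3 * c2 n1 + 2 * c2 n2 + c2 n3) &&
  (Nat.ble 9 (c2 n1 + 2 * c2 n2 + 3 * c2 n3 + 4 * c2 n4) &&
  (Nat.ble 36 (4 * c1 n0 + 3 * c1 n1 + 2 * c1 n2 + c1 n3) &&
  (Nat.ble 36 (c1 n1 + 2 * c1 n2 + 3 * c1 n3 + 4 * c1 n4) &&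
  (Nat.ble 36 (4 * c0 n0 + 3 * c0 n1 + 2 * c0 n2 + c0 n3) &&
  Nat.ble 36 (c0 n1 + 2 * c0 n2 + 3 * c0 n3 + 4 * c0 n4))))))

def rowsOf : ℕ → List ℕ
  | 0 => [0]
  | 1 => [1,2,4,8,16]
  | 2 => [3,5,6,9,10,12,17,18,20,24]
  | 3 => [7,11,13,14,19,21,22,25,26,28]
  | 4 => [15,23,27,29,30]
  | _ => [31]

/-- the sixteen surviving 0/1-patterns with at most eight ones. -/
def L16 : List (List ℕ) :=
  [[2,10,25,0,9], [4,6,19,0,18], [4,12,25,0,9], [4,13,0,24,5], [4,13,24,0,5],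
   [4,22,0,3,20], [4,22,3,0,20], [5,0,24,13,4], [5,24,0,13,4], [8,10,19,0,18],
   [9,0,25,10,2], [9,0,25,12,4], [18,0,19,6,4], [18,0,19,10,8], [20,0,3,22,4],
   [20,3,0,22,4]]

def ns : List ℕ := [0,1,2,3,4,5]

def search : Bool :=
  ns.all fun n0 => ns.all fun n1 => ns.all fun n2 => ns.all fun n3 => ns.all fun n4 =>
    !(seqOk n0 n1 n2 n3 n4) ||
    ((rowsOf n0).all fun r0 => (rowsOf n1).all fun r1 => (rowsOf n2).all fun r2 =>
     (rowsOf n3).all fun r3 => !(topOk r0 r1 r2 r3) ||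
      ((rowsOf n4).all fun r4 => !(botOk r1 r2 r3 r4) ||
        (!(good r0 r1 r2 r3 r4) || L16.contains [r0,r1,r2,r3,r4])))

theorem search_true : search = true := by decide +kernel

theorem cnt_land : ∀ ra < 32, ∀ rb < 32, ∀ t < 4, ∀ b < 4,
    (E t ra).land (E b rb) % 255 = cnt t b ra rb ∧ cnt t b ra rb ≤ 10 := by
  decide +kernel

theorem F_eq : ∀ r < 32, ∀ t < 4,
    F t r = (prs.map fun p => cond (Nat.beq (pat r p) t) 1 0).sum := by
  decide +kernel

theorem sum_four (l : List (ℕ × ℕ)) (f0 f1 f2 f3 g : ℕ × ℕ → ℕ)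
    (h : ∀ p, f0 p + f1 p + f2 p + f3 p = g p) :
    (l.map f0).sum + (l.map f1).sum + (l.map f2).sum + (l.map f3).sum = (l.map g).sum := by
  induction l with
  | nil => rfl
  | cons p l ih =>
    simp only [List.map_cons, List.sum_cons]
    rw [← ih, ← h p]
    ring

theorem marg_top (ra : ℕ) (ha : ra < 32) (rb : ℕ) (_ : rb < 32) (t : ℕ) (ht : t < 4) :
    cnt t 0 ra rb + cnt t 1 ra rb + cnt t 2 ra rb + cnt t 3 ra rb = F t ra := by
  rw [F_eq ra ha t ht]
  refine sum_four _ _ _ _ _ _ fun p => ?_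
  cases Nat.beq (pat ra p) t
  · rfl
  · unfold pat
    cases rb.testBit p.1 <;> cases rb.testBit p.2 <;> rfl

theorem marg_bot (ra : ℕ) (_ : ra < 32) (rb : ℕ) (hb : rb < 32) (b : ℕ) (hb4 : b < 4) :
    cnt 0 b ra rb + cnt 1 b ra rb + cnt 2 b ra rb + cnt 3 b ra rb = F b rb := by
  rw [F_eq rb hb b hb4]
  refine sum_four _ _ _ _ _ _ fun p => ?_
  cases Nat.beq (pat rb p) b
  · simp only [Bool.and_false, cond_false]
  · unfold pat
    cases ra.testBit p.1 <;> cases ra.testBit p.2 <;> rfl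

theorem row_facts : ∀ r < 32, F 3 r = c2 (pop r) ∧ F 0 r = c0 (pop r) ∧
    F 1 r + F 2 r = c1 (pop r) ∧ r ∈ rowsOf (pop r) ∧ pop r ∈ ns := by
  decide +kernel

/-- total pattern count. -/
def tot (t b r0 r1 r2 r3 r4 : ℕ) : ℕ :=
  cnt t b r0 r1 + cnt t b r0 r2 + cnt t b r0 r3 + cnt t b r0 r4 + cnt t b r1 r2
  + cnt t b r1 r3 + cnt t b r1 r4 + cnt t b r2 r3 + cnt t b r2 r4 + cnt t b r3 r4

section
variable {r0 r1 r2 r3 r4 : ℕ}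

theorem hh_eq (h0 : r0 < 32) (h1 : r1 < 32) (h2 : r2 < 32) (h3 : r3 < 32) (h4 : r4 < 32)
    {t b : ℕ} (ht : t < 4) (hb : b < 4) :
    hh t b r0 r1 r2 r3 r4 = tot t b r0 r1 r2 r3 r4 := by
  have a01 := cnt_land r0 h0 r1 h1 t ht b hb
  have a02 := cnt_land r0 h0 r2 h2 t ht b hb
  have a03 := cnt_land r0 h0 r3 h3 t ht b hb
  have a04 := cnt_land r0 h0 r4 h4 t ht b hb
  have a12 := cnt_land r1 h1 r2 h2 t ht b hb
  have a13 := cnt_land r1 h1 r3 h3 t ht b hb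
  have a14 := cnt_land r1 h1 r4 h4 t ht b hb
  have a23 := cnt_land r2 h2 r3 h3 t ht b hb
  have a24 := cnt_land r2 h2 r4 h4 t ht b hb
  have a34 := cnt_land r3 h3 r4 h4 t ht b hb
  unfold hh tot
  omega

theorem tot_top (h0 : r0 < 32) (h1 : r1 < 32) (h2 : r2 < 32) (h3 : r3 < 32) (h4 : r4 < 32)
    {t : ℕ} (ht : t < 4) :
    tot t 0 r0 r1 r2 r3 r4 + tot t 1 r0 r1 r2 r3 r4 + tot t 2 r0 r1 r2 r3 r4
      + tot t 3 r0 r1 r2 r3 r4 = 4 * F t r0 + 3 * F t r1 + 2 * F t r2 + F t r3 := by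
  have a01 := marg_top r0 h0 r1 h1 t ht
  have a02 := marg_top r0 h0 r2 h2 t ht
  have a03 := marg_top r0 h0 r3 h3 t ht
  have a04 := marg_top r0 h0 r4 h4 t ht
  have a12 := marg_top r1 h1 r2 h2 t ht
  have a13 := marg_top r1 h1 r3 h3 t ht
  have a14 := marg_top r1 h1 r4 h4 t ht
  have a23 := marg_top r2 h2 r3 h3 t ht
  have a24 := marg_top r2 h2 r4 h4 t ht
  have a34 := marg_top r3 h3 r4 h4 t ht
  unfold tot
  linarith

theorem tot_bot (h0 : r0 < 32) (h1 : r1 < 32) (h2 : r2 < 32) (h3 : r3 < 32) (h4 : r4 < 32)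
    {b : ℕ} (hb : b < 4) :
    tot 0 b r0 r1 r2 r3 r4 + tot 1 b r0 r1 r2 r3 r4 + tot 2 b r0 r1 r2 r3 r4
      + tot 3 b r0 r1 r2 r3 r4 = F b r1 + 2 * F b r2 + 3 * F b r3 + 4 * F b r4 := by
  have a01 := marg_bot r0 h0 r1 h1 b hb
  have a02 := marg_bot r0 h0 r2 h2 b hb
  have a03 := marg_bot r0 h0 r3 h3 b hb
  have a04 := marg_bot r0 h0 r4 h4 b hb
  have a12 := marg_bot r1 h1 r2 h2 b hb
  have a13 := marg_bot r1 h1 r3 h3 b hb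
  have a14 := marg_bot r1 h1 r4 h4 b hb
  have a23 := marg_bot r2 h2 r3 h3 b hb
  have a24 := marg_bot r2 h2 r4 h4 b hb
  have a34 := marg_bot r3 h3 r4 h4 b hb
  unfold tot
  linarith

theorem core (h0 : r0 < 32) (h1 : r1 < 32) (h2 : r2 < 32) (h3 : r3 < 32) (h4 : r4 < 32)
    (H : ∀ t < 4, ∀ b < 4, need t b ≤ tot t b r0 r1 r2 r3 r4)
    (hp : pop r0 + pop r1 + pop r2 + pop r3 + pop r4 ≤ 8) :
    [r0, r1, r2, r3, r4] ∈ L16 := by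
  obtain ⟨f0, g0, k0, m0, p0⟩ := row_facts r0 h0
  obtain ⟨f1, g1, k1, m1, p1⟩ := row_facts r1 h1
  obtain ⟨f2, g2, k2, m2, p2⟩ := row_facts r2 h2
  obtain ⟨f3, g3, k3, m3, p3⟩ := row_facts r3 h3
  obtain ⟨f4, g4, k4, m4, p4⟩ := row_facts r4 h4
  have T : ∀ t < 4, need t 0 + need t 1 + need t 2 + need t 3 ≤
      4 * F t r0 + 3 * F t r1 + 2 * F t r2 + F t r3 := by
    intro t ht
    have := tot_top h0 h1 h2 h3 h4 ht
    have := H t ht 0 (by norm_num)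
    have := H t ht 1 (by norm_num)
    have := H t ht 2 (by norm_num)
    have := H t ht 3 (by norm_num)
    omega
  have B : ∀ t < 4, need 0 t + need 1 t + need 2 t + need 3 t ≤
      F t r1 + 2 * F t r2 + 3 * F t r3 + 4 * F t r4 := by
    intro t ht
    have := tot_bot h0 h1 h2 h3 h4 ht
    have := H 0 (by norm_num) t ht
    have := H 1 (by norm_num) t ht
    have := H 2 (by norm_num) t ht
    have := H 3 (by norm_num) t ht
    omega
  have T0 := T 0 (by norm_num)
  have T1 := T 1 (by norm_num)
  have T2 := T 2 (by norm_num)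
  have T3 := T 3 (by norm_num)
  have B0 := B 0 (by norm_num)
  have B1 := B 1 (by norm_num)
  have B2 := B 2 (by norm_num)
  have B3 := B 3 (by norm_num)
  simp only [need] at T0 T1 T2 T3 B0 B1 B2 B3
  have hs : seqOk (pop r0) (pop r1) (pop r2) (pop r3) (pop r4) = true := by
    simp only [seqOk, Bool.and_eq_true, Nat.ble_eq]
    refine ⟨hp, ?_, ?_, ?_, ?_, ?_, ?_⟩ <;> omega
  have ht : topOk r0 r1 r2 r3 = true := by
    simp only [topOk, Bool.and_eq_true, Nat.ble_eq]
    constructor <;> omega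
  have hb : botOk r1 r2 r3 r4 = true := by
    simp only [botOk, Bool.and_eq_true, Nat.ble_eq]
    constructor <;> omega
  have hc : ∀ t < 4, ∀ b < 4, chk t b r0 r1 r2 r3 r4 = true := by
    intro t ht b hb
    simp only [chk, Nat.ble_eq]
    rw [hh_eq h0 h1 h2 h3 h4 ht hb]
    exact H t ht b hb
  have hg : good r0 r1 r2 r3 r4 = true := by
    simp only [good, Bool.and_eq_true]
    refine ⟨?_, ?_, ?_, ?_, ?_, ?_, ?_, ?_, ?_, ?_, ?_, ?_⟩ <;>
      exact hc _ (by norm_num) _ (by norm_num)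
  have hS := search_true
  unfold search at hS
  have s1 := List.all_eq_true.1 hS _ p0
  have s2 := List.all_eq_true.1 s1 _ p1
  have s3 := List.all_eq_true.1 s2 _ p2
  have s4 := List.all_eq_true.1 s3 _ p3
  have s5 := List.all_eq_true.1 s4 _ p4
  rw [hs, Bool.not_true, Bool.false_or] at s5
  have s6 := List.all_eq_true.1 s5 _ m0
  have s7 := List.all_eq_true.1 s6 _ m1
  have s8 := List.all_eq_true.1 s7 _ m2
  have s9 := List.all_eq_true.1 s8 _ m3
  rw [ht, Bool.not_true, Bool.false_or] at s9
  have s10 := List.all_eq_true.1 s9 _ m4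
  rw [hb, hg, Bool.not_true, Bool.false_or, Bool.false_or] at s10
  simpa using s10

end

theorem disj_L16 : ∀ A ∈ L16, ∀ B ∈ L16, ∃ i : Fin 5, ∃ j : Fin 5,
    (A.getD i 0).testBit j = true ∧ (B.getD i 0).testBit j = true := by
  decide +kernel

theorem pop_L16 : ∀ A ∈ L16, (A.map pop).sum = 8 := by
  decide +kernel

theorem exists_mask : ∀ u : Fin 5 → Bool, ∃ r : Fin 32, ∀ j : Fin 5,
    Nat.testBit r j = u j := by
  decide +kernel

/-- the pairs as a function. -/
def pr : Fin 10 → Fin 5 × Fin 5 :=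
  ![(0,1),(0,2),(0,3),(0,4),(1,2),(1,3),(1,4),(2,3),(2,4),(3,4)]

theorem exists_pr : ∀ i j : Fin 5, i < j → ∃ k, pr k = (i, j) := by decide +kernel

theorem prs_sum (f : ℕ × ℕ → ℕ) :
    (prs.map f).sum = ∑ l : Fin 10, f ((pr l).1, (pr l).2) := by
  simp [Fin.sum_univ_succ, prs, pr]

theorem cnt_sum (t b ra rb : ℕ) : cnt t b ra rb = ∑ l : Fin 10,
    if pat ra ((pr l).1, (pr l).2) = t ∧ pat rb ((pr l).1, (pr l).2) = b then 1 else 0 := by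
  have e : ∀ p, (cond (Nat.beq (pat ra p) t && Nat.beq (pat rb p) b) 1 0 : ℕ)
      = if pat ra p = t ∧ pat rb p = b then 1 else 0 := by
    intro p
    simp only [← Nat.beq_eq, ← Bool.and_eq_true]
    cases (Nat.beq (pat ra p) t && Nat.beq (pat rb p) b) <;> rfl
  simp only [cnt, e]
  exact prs_sum fun p => if pat ra p = t ∧ pat rb p = b then 1 else 0

theorem tot_sum (t b : ℕ) (r : Fin 5 → ℕ) : tot t b (r 0) (r 1) (r 2) (r 3) (r 4) =
    ∑ k : Fin 10, cnt t b (r (pr k).1) (r (pr k).2) := by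
  simp [Fin.sum_univ_succ, pr, tot]
  simp only [add_assoc]

/-- pattern code of two letters relative to the letter `a`. -/
def code (a x y : Fin 3) : ℕ :=
  cond (x == a) (cond (y == a) 3 1) (cond (y == a) 2 0)

theorem code_card : ∀ a : Fin 3, ∀ t < 4, ∀ b < 4, need t b ≤
    (Finset.univ.filter fun q : (Fin 3 × Fin 3) × (Fin 3 × Fin 3) =>
      code a q.1.1 q.1.2 = t ∧ code a q.2.1 q.2.2 = b).card := by
  decide +kernel

theorem need_le (M : Fin 5 → Fin 5 → Fin 3) (hM : IsOmnimosaic 3 2 M) (a : Fin 3)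
    (r : Fin 5 → ℕ) (hr : ∀ i j : Fin 5, (r i).testBit j = (M i j == a)) :
    ∀ t < 4, ∀ b < 4, need t b ≤ tot t b (r 0) (r 1) (r 2) (r 3) (r 4) := by
  intro t ht b hb
  refine (code_card a t ht b hb).trans ?_
  have e1 : tot t b (r 0) (r 1) (r 2) (r 3) (r 4) =
      (Finset.univ.filter fun p : Fin 10 × Fin 10 =>
        pat (r (pr p.1).1) ((pr p.2).1, (pr p.2).2) = t ∧
        pat (r (pr p.1).2) ((pr p.2).1, (pr p.2).2) = b).card := by
    rw [tot_sum, Finset.card_filter, Fintype.sum_prod_type]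
    exact Finset.sum_congr rfl fun k _ => cnt_sum _ _ _ _
  rw [e1]
  have hpat : ∀ i x y : Fin 5, pat (r i) (x, y) = code a (M i x) (M i y) := by
    intro i x y
    simp only [pat, code, hr]
  simp only [hpat]
  refine Finset.card_le_card_of_surjOn
    (fun p => ((M (pr p.1).1 (pr p.2).1, M (pr p.1).1 (pr p.2).2),
      (M (pr p.1).2 (pr p.2).1, M (pr p.1).2 (pr p.2).2))) ?_
  rintro ⟨⟨x, y⟩, ⟨z, w⟩⟩ hq
  obtain ⟨ρ, σ, hρ, hσ, h⟩ := hM ![![x, y], ![z, w]]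
  obtain ⟨k, hk⟩ := exists_pr (ρ 0) (ρ 1) (hρ (by decide))
  obtain ⟨l, hl⟩ := exists_pr (σ 0) (σ 1) (hσ (by decide))
  have h00 := h 0 0
  have h01 := h 0 1
  have h10 := h 1 0
  have h11 := h 1 1
  simp at h00 h01 h10 h11 hq
  refine ⟨(k, l), ?_, ?_⟩
  · simp [hk, hl, ← h00, ← h01, ← h10, ← h11, hq]
  · simp [hk, hl, ← h00, ← h01, ← h10, ← h11]

theorem pop_sum (r : ℕ) : pop r = ∑ j : Fin 5, cond (r.testBit j) 1 0 := by
  simp [pop, Fin.sum_univ_succ]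

end Omni

theorem no_O_5_2_3 : ¬ ∃ M : Fin 5 → Fin 5 → Fin 3, IsOmnimosaic 3 2 M := by
  rintro ⟨M, hM⟩
  have hex : ∀ (a : Fin 3) (i : Fin 5), ∃ r : Fin 32, ∀ j : Fin 5,
      Nat.testBit r j = (M i j == a) := fun a i => Omni.exists_mask fun j => M i j == a
  choose r hr using hex
  have mem : ∀ a : Fin 3, ∑ i : Fin 5, Omni.pop (r a i) ≤ 8 →
      [(r a 0 : ℕ), r a 1, r a 2, r a 3, r a 4] ∈ Omni.L16 := by
    intro a ha
    refine Omni.core (r a 0).2 (r a 1).2 (r a 2).2 (r a 3).2 (r a 4).2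
      (Omni.need_le M hM a (fun i => (r a i : ℕ)) (fun i j => hr a i j)) ?_
    rwa [Fin.sum_univ_five] at ha
  have total : ∑ a : Fin 3, ∑ i : Fin 5, Omni.pop (r a i) = 25 := by
    simp only [Omni.pop_sum, hr]
    rw [Finset.sum_comm]
    have : ∀ i : Fin 5, ∑ a : Fin 3, ∑ j : Fin 5, (cond (M i j == a) 1 0 : ℕ) = 5 := by
      intro i
      rw [Finset.sum_comm]
      have : ∀ x : Fin 3, ∑ a : Fin 3, (cond (x == a) 1 0 : ℕ) = 1 := by decide
      simp [this]
    simp [this]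
  have clash : ∀ a b : Fin 3, a ≠ b → ∑ i : Fin 5, Omni.pop (r a i) ≤ 8 →
      ∑ i : Fin 5, Omni.pop (r b i) ≤ 8 → False := by
    intro a b hab ha hb
    obtain ⟨i, j, h1, h2⟩ := Omni.disj_L16 _ (mem a ha) _ (mem b hb)
    have key : ∀ c : Fin 3, [(r c 0 : ℕ), r c 1, r c 2, r c 3, r c 4].getD i 0 = r c i := by
      intro c
      fin_cases i <;> rfl
    rw [key, hr] at h1 h2
    simp only [beq_iff_eq] at h1 h2
    exact hab (h1.symm.trans h2)
  have eight : ∀ a : Fin 3, 8 ≤ ∑ i : Fin 5, Omni.pop (r a i) := by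
    intro a
    by_contra hlt
    have h8 := Omni.pop_L16 _ (mem a (by omega))
    rw [Fin.sum_univ_five] at hlt
    simp only [List.map_cons, List.map_nil, List.sum_cons, List.sum_nil] at h8
    omega
  have e0 := eight 0
  have e1 := eight 1
  have e2 := eight 2
  rw [Fin.sum_univ_three] at total
  have c01 := clash 0 1 (by decide)
  have c02 := clash 0 2 (by decide)
  have c12 := clash 1 2 (by decide)
  by_cases k0 : ∑ i : Fin 5, Omni.pop (r 0 i) ≤ 8 <;>
  by_cases k1 : ∑ i : Fin 5, Omni.pop (r 1 i) ≤ 8 <;>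
  by_cases k2 : ∑ i : Fin 5, Omni.pop (r 2 i) ≤ 8 <;>
  first
  | exact c01 k0 k1
  | exact c02 k0 k2
  | exact c12 k1 k2
  | omega
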